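/- Let Z_1,…,Z_N be i.i.d. real random variables with distribution function F having density f, with N even. Then the distribution function of the sample median Z = (Z_{(N/2)} + Z_{(N/2+1)})/2 is F_Z^E(z) = (2/B(N/2,N/2)) ∫_{-∞}^z [F(x)]^{(N/2)−1} { [1−F(x)]^{N/2} − [1−F(2z−x)]^{N/2} } f(x) dx, where B(·,·) is the Beta function. -/

import Mathlib

open MeasureTheory ProbabilityTheory Filter Asymptotics Set
open scoped Topology ENNReal NNReal BigOperators

noncomputable section

/-- The `k`-th order statistic (1-indexed) of a finite sample: the smallest point `x`
such that at least `k` of the observations are `≤ x`. -/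
def orderStat {N : ℕ} (w : Fin N → ℝ) (k : ℕ) : ℝ :=
  sInf {x : ℝ | k ≤ (Finset.univ.filter fun i => w i ≤ x).card}

/-- The sample median: the `((N+1)/2)`-th order statistic for odd `N`, the average of the
`(N/2)`-th and `(N/2+1)`-th order statistics for even `N`. -/
def sampleMedian {N : ℕ} (w : Fin N → ℝ) : ℝ :=
  if N % 2 = 1 then orderStat w ((N + 1) / 2)
  else (orderStat w (N / 2) + orderStat w (N / 2 + 1)) / 2

/-- The measure on `ℝ` with Lebesgue density `f`. -/
def densMeasure (f : ℝ → ℝ) : Measure ℝ :=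
  MeasureTheory.volume.withDensity fun x => ENNReal.ofReal (f x)

/-- Joint law of the two independent samples: `X_1, …, X_m` i.i.d. with density `f`
and `Y_1, …, Y_n` i.i.d. with density `f(· - θ)`, all independent. -/
def twoSampleLaw (f : ℝ → ℝ) (m n : ℕ) (θ : ℝ) :
    Measure ((Fin m → ℝ) × (Fin n → ℝ)) :=
  (Measure.pi fun _ : Fin m => densMeasure f).prod
    (Measure.pi fun _ : Fin n => (densMeasure f).map (· + θ))

/-- Integrated kernel `K(t) = ∫_{-∞}^t k(u) du`. -/
def Kfun (k : ℝ → ℝ) (t : ℝ) : ℝ := ∫ u in Set.Iic t, k u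

/-- The median test statistic `M† = ∑_{i=1}^m ψ*(Z - X_i)` with `ψ*(x) = 1` for `x > 0`. -/
def MdagStat {m n : ℕ} (p : (Fin m → ℝ) × (Fin n → ℝ)) : ℝ :=
  ∑ i : Fin m, if 0 < sampleMedian (Fin.append p.1 p.2) - p.1 i then (1:ℝ) else 0

/-- The smoothed median test statistic `M̃ = ∑_{i=1}^m K*((Z - X_i)/h)`. -/
def MtilStat (kstar : ℝ → ℝ) (h : ℝ) {m n : ℕ} (p : (Fin m → ℝ) × (Fin n → ℝ)) : ℝ :=
  ∑ i : Fin m, Kfun kstar ((sampleMedian (Fin.append p.1 p.2) - p.1 i) / h)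

/-- The Wilcoxon rank sum statistic `W₂ = ∑_i ∑_j ψ(Y_j - X_i)` with `ψ(x) = 1` for `x ≥ 0`. -/
def W2Stat {m n : ℕ} (p : (Fin m → ℝ) × (Fin n → ℝ)) : ℝ :=
  ∑ i : Fin m, ∑ j : Fin n, if 0 ≤ p.2 j - p.1 i then (1:ℝ) else 0

/-- The smoothed Wilcoxon statistic `W̃₂ = ∑_i ∑_j K((Y_j - X_i)/h)`. -/
def WtilStat (k : ℝ → ℝ) (h : ℝ) {m n : ℕ} (p : (Fin m → ℝ) × (Fin n → ℝ)) : ℝ :=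
  ∑ i : Fin m, ∑ j : Fin n, Kfun k ((p.2 j - p.1 i) / h)

/-- The standard normal distribution function `Φ`. -/
def stdGaussCDF (x : ℝ) : ℝ :=
  ((ProbabilityTheory.gaussianReal 0 1) (Set.Iic x)).toReal

/-- The Beta function `B(a,b) = ∫_0^1 t^{a-1} (1-t)^{b-1} dt`. -/
def Beta (a b : ℝ) : ℝ := ∫ t in Set.Ioo (0:ℝ) 1, t ^ (a - 1) * (1 - t) ^ (b - 1)

/-- The Beta function of the definitions agrees with Mathlib's `ProbabilityTheory.beta`. -/
theorem Beta_eq_beta {a b : ℝ} (ha : 0 < a) (hb : 0 < b) : Beta a b = beta a b := by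
  have h := lintegral_betaPDF_eq_one ha hb
  have hpos := beta_pos ha hb
  rw [lintegral_betaPDF] at h
  have hnn : 0 ≤ᵐ[volume.restrict (Ioo (0:ℝ) 1)]
      fun x : ℝ => 1 / beta a b * x ^ (a - 1) * (1 - x) ^ (b - 1) := by
    filter_upwards [ae_restrict_mem measurableSet_Ioo] with x hx
    have h1 : 0 ≤ x := hx.1.le
    have h2 : 0 ≤ 1 - x := by linarith [hx.2]
    simp only [Pi.zero_apply]
    positivity
  have hint := integral_eq_lintegral_of_nonneg_ae hnn (by fun_prop)
  rw [h] at hint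
  simp only [mul_assoc, integral_const_mul, ENNReal.toReal_one] at hint
  change 1 / beta a b * Beta a b = 1 at hint
  field_simp at hint
  exact hint

theorem two_div_Beta (s : ℕ) :
    2 / Beta ((s : ℝ) + 1) ((s : ℝ) + 1) = ((2 * s + 2 : ℕ) : ℝ) * ((2 * s + 1).choose s : ℝ) := by
  rw [Beta_eq_beta (by positivity) (by positivity), beta, Real.Gamma_nat_eq_factorial,
    show (s : ℝ) + 1 + (s + 1) = ((2 * s + 1 : ℕ) : ℝ) + 1 by push_cast; ring,
    Real.Gamma_nat_eq_factorial, Nat.cast_choose ℝ (by omega : s ≤ 2 * s + 1),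
    show 2 * s + 1 - s = s + 1 by omega, Nat.factorial_succ s]
  have := Nat.factorial_ne_zero s
  push_cast
  field_simp

section OrderStatistics

variable {N : ℕ} (w : Fin N → ℝ)

theorem orderStat_eq_of_card {w : Fin N → ℝ} {k : ℕ} {i : Fin N}
    (hlt : (Finset.univ.filter fun j => w j < w i).card < k)
    (hle : k ≤ (Finset.univ.filter fun j => w j ≤ w i).card) : orderStat w k = w i := by
  refine IsLeast.csInf_eq ⟨hle, fun x (hx : k ≤ _) => ?_⟩
  by_contra! hxi
  refine absurd (hx.trans (Finset.card_le_card fun j hj => ?_)) hlt.not_ge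
  simp only [Finset.mem_filter, Finset.mem_univ, true_and] at hj ⊢
  linarith

theorem exists_card_lt_le {k : ℕ} (hk : 1 ≤ k) (hkN : k ≤ N) :
    ∃ i : Fin N, (Finset.univ.filter fun j => w j < w i).card < k ∧
      k ≤ (Finset.univ.filter fun j => w j ≤ w i).card := by
  have : Nonempty (Fin N) := ⟨⟨0, by omega⟩⟩
  obtain ⟨m, -, hm⟩ := Finset.exists_max_image Finset.univ w Finset.univ_nonempty
  obtain ⟨i, hi, hmin⟩ := Finset.exists_min_image
    (Finset.univ.filter fun i => k ≤ (Finset.univ.filter fun j => w j ≤ w i).card) w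
    ⟨m, by simpa [Finset.filter_true_of_mem hm] using hkN⟩
  simp only [Finset.mem_filter, Finset.mem_univ, true_and] at hi hmin
  refine ⟨i, ?_, hi⟩
  by_contra! hcon
  obtain ⟨l, hl, hlmax⟩ := Finset.exists_max_image (Finset.univ.filter fun j => w j < w i) w
    (Finset.card_pos.1 (by omega))
  simp only [Finset.mem_filter, Finset.mem_univ, true_and] at hl hlmax
  refine absurd (hmin l (hcon.trans (Finset.card_le_card fun j hj => ?_))) hl.not_ge
  simp only [Finset.mem_filter, Finset.mem_univ, true_and] at hj ⊢
  exact hlmax j hj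

theorem orderStat_le_iff {k : ℕ} (hk : 1 ≤ k) (hkN : k ≤ N) (x : ℝ) :
    orderStat w k ≤ x ↔ k ≤ (Finset.univ.filter fun j => w j ≤ x).card := by
  obtain ⟨i, hlt, hle⟩ := exists_card_lt_le w hk hkN
  rw [orderStat_eq_of_card hlt hle]
  constructor
  · intro h
    refine hle.trans (Finset.card_le_card fun j hj => ?_)
    simp only [Finset.mem_filter, Finset.mem_univ, true_and] at hj ⊢
    exact hj.trans h
  · intro h
    by_contra! hxi
    refine absurd (h.trans (Finset.card_le_card fun j hj => ?_)) hlt.not_ge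
    simp only [Finset.mem_filter, Finset.mem_univ, true_and] at hj ⊢
    linarith

end OrderStatistics

theorem card_filter_univ_succAbove {n : ℕ} (p : Fin (n + 1) → Prop) [DecidablePred p]
    (i : Fin (n + 1)) :
    (Finset.univ.filter p).card =
      (if p i then 1 else 0) + (Finset.univ.filter fun j => p (i.succAbove j)).card := by
  simp only [Finset.card_filter, Fin.sum_univ_succAbove _ i]

/-- The event that, for a distinguished observation `p.1` and remaining observations `p.2`, the
observations below `p.1` are exactly those indexed by `S`, and the average of `p.1` and the next
larger observation is at most `z`. -/
def medianCell (z : ℝ) {n : ℕ} (S : Finset (Fin n)) : Set (ℝ × (Fin n → ℝ)) :=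
  {p | p.1 ≤ z ∧ (∀ j ∈ S, p.2 j < p.1) ∧ (∀ j, j ∉ S → p.1 < p.2 j) ∧
    ∃ j, j ∉ S ∧ p.2 j ≤ 2 * z - p.1}

theorem measurableSet_medianCell (z : ℝ) {n : ℕ} (S : Finset (Fin n)) :
    MeasurableSet (medianCell z S) := by
  have h1 : ∀ j : Fin n, Measurable fun p : ℝ × (Fin n → ℝ) => p.2 j := fun j => by fun_prop
  have heq : medianCell z S = {p | p.1 ≤ z} ∩ ((⋂ j ∈ S, {p | p.2 j < p.1}) ∩
      ((⋂ j ∈ Sᶜ, {p | p.1 < p.2 j}) ∩ ⋃ j ∈ Sᶜ, {p | p.2 j ≤ 2 * z - p.1})) := by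
    ext p
    simp [medianCell]
  rw [heq]
  refine (measurableSet_le measurable_fst measurable_const).inter (.inter ?_ (.inter ?_ ?_))
  · exact Finset.measurableSet_biInter _ fun j _ => measurableSet_lt (h1 j) measurable_fst
  · exact Finset.measurableSet_biInter _ fun j _ => measurableSet_lt measurable_fst (h1 j)
  · exact Finset.measurableSet_biUnion _ fun j _ =>
      measurableSet_le (h1 j) (measurable_const.sub measurable_fst)

section Cells

variable (μ : Measure ℝ) [IsProbabilityMeasure μ] [NullSingletonClass μ]

theorem pi_real_box {n : ℕ} (S : Finset (Fin n)) (x t : ℝ) :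
    (Measure.pi fun _ : Fin n => μ).real
        (univ.pi fun j => if j ∈ S then Iio x else Ioi t) =
      μ.real (Iic x) ^ S.card * (1 - μ.real (Iic t)) ^ (n - S.card) := by
  have hlt : μ.real (Iio x) = μ.real (Iic x) := measureReal_congr Iio_ae_eq_Iic
  have hgt : μ.real (Ioi t) = 1 - μ.real (Iic t) := by
    rw [← compl_Iic, probReal_compl_eq_one_sub measurableSet_Iic]
  rw [measureReal_def, Measure.pi_pi, ENNReal.toReal_prod]
  have : ∀ j : Fin n, (μ (if j ∈ S then Iio x else Ioi t)).toReal =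
      if j ∈ S then μ.real (Iic x) else 1 - μ.real (Iic t) := by
    intro j
    split_ifs
    · exact hlt
    · exact hgt
  simp only [this, Finset.prod_ite, Finset.prod_const, Finset.filter_univ_mem]
  rw [Finset.filter_not, Finset.filter_univ_mem, Finset.card_sdiff_of_subset (Finset.subset_univ _),
    Finset.card_univ, Fintype.card_fin]

theorem pi_real_medianCell_slice {n : ℕ} (S : Finset (Fin n)) {x z : ℝ} (hx : x ≤ z) :
    (Measure.pi fun _ : Fin n => μ).real (Prod.mk x ⁻¹' medianCell z S) =
      μ.real (Iic x) ^ S.card * ((1 - μ.real (Iic x)) ^ (n - S.card) -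
        (1 - μ.real (Iic (2 * z - x))) ^ (n - S.card)) := by
  have hmeas : ∀ t : ℝ, MeasurableSet
      (univ.pi fun j : Fin n => if j ∈ S then Iio x else Ioi t) := fun t =>
    .univ_pi fun j => by split_ifs <;> measurability
  have hslice : Prod.mk x ⁻¹' medianCell z S =
      (univ.pi fun j => if j ∈ S then Iio x else Ioi x) \
        (univ.pi fun j => if j ∈ S then Iio x else Ioi (2 * z - x)) := by
    ext v
    simp only [medianCell, mem_preimage, mem_ofPred_eq, Set.mem_sdiff, Set.mem_pi, mem_univ,
      forall_true_left]
    constructor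
    · rintro ⟨-, h1, h2, j, hj, hjz⟩
      refine ⟨fun i => ?_, fun h => ?_⟩
      · split_ifs with hi
        exacts [h1 i hi, h2 i hi]
      · have := h j
        rw [if_neg hj] at this
        exact absurd hjz (not_le.2 this)
    · rintro ⟨h, h'⟩
      push Not at h'
      obtain ⟨j, hj⟩ := h'
      have hmem : ∀ i ∈ S, v i < x := fun i hi => by simpa [hi] using h i
      by_cases hjS : j ∈ S
      · exact absurd (hmem j hjS) (by simpa [hjS] using hj)
      · exact ⟨hx, hmem, fun i hi => by simpa [hi] using h i, j, hjS, by simpa [hjS] using hj⟩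
  rw [hslice, measureReal_sdiff _ (hmeas _), pi_real_box, pi_real_box]
  · ring
  · refine pi_mono fun j _ => ?_
    split_ifs
    · exact subset_rfl
    · exact Ioi_subset_Ioi (by linarith)

theorem prod_real_medianCell {n : ℕ} (S : Finset (Fin n)) (z : ℝ) :
    (μ.prod (Measure.pi fun _ : Fin n => μ)).real (medianCell z S) =
      ∫ x in Iic z, μ.real (Iic x) ^ S.card * ((1 - μ.real (Iic x)) ^ (n - S.card) -
        (1 - μ.real (Iic (2 * z - x))) ^ (n - S.card)) ∂μ := by
  have hm := measurableSet_medianCell z S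
  rw [measureReal_def, Measure.prod_apply hm,
    ← integral_toReal (measurable_measure_prodMk_left hm).aemeasurable
      (.of_forall fun _ => measure_lt_top _ _), ← integral_indicator measurableSet_Iic]
  refine integral_congr_ae (.of_forall fun x => ?_)
  by_cases hx : x ≤ z
  · simp only [indicator_of_mem (mem_Iic.2 hx)]
    exact pi_real_medianCell_slice μ S hx
  · have hempty : Prod.mk x ⁻¹' medianCell z S = ∅ :=
      eq_empty_of_forall_notMem fun v hv => hx hv.1
    simp [hempty, hx]

theorem ae_pi_ne_succAbove {n : ℕ} :
    ∀ᵐ w ∂(Measure.pi fun _ : Fin (n + 1) => μ), ∀ (i : Fin (n + 1)) (j : Fin n),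
      w (i.succAbove j) ≠ w i := by
  refine ae_all_iff.2 fun i => ae_all_iff.2 fun j => ?_
  have hmp := measurePreserving_piFinSuccAbove (fun _ : Fin (n + 1) => μ) i
  have h : ∀ᵐ p ∂(μ.prod (Measure.pi fun _ : Fin n => μ)), p.2 j ≠ p.1 := by
    have hms : MeasurableSet {p : ℝ × (Fin n → ℝ) | ¬ p.2 j ≠ p.1} := by
      simp only [not_not]
      exact measurableSet_eq_fun (by fun_prop) (by fun_prop)
    refine (Measure.measure_prod_null hms).2 (.of_forall fun x => ?_)
    simpa using Measure.pi_hyperplane (fun _ : Fin n => μ) j x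
  exact hmp.quasiMeasurePreserving.ae h

end Cells

theorem card_lt_of_mem_medianCell {n : ℕ} {w : Fin (n + 1) → ℝ} {z : ℝ} {i : Fin (n + 1)}
    {S : Finset (Fin n)} (h : (w i, fun j => w (i.succAbove j)) ∈ medianCell z S) :
    S = (Finset.univ.filter fun j => w (i.succAbove j) < w i) ∧
      (Finset.univ.filter fun j => w j < w i).card = S.card := by
  obtain ⟨-, h1, h2, -⟩ := h
  have hS : S = (Finset.univ.filter fun j => w (i.succAbove j) < w i) := by
    ext j
    simp only [Finset.mem_filter, Finset.mem_univ, true_and]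
    exact ⟨h1 j, fun h => by_contra fun hj => lt_asymm h (h2 j hj)⟩
  refine ⟨hS, ?_⟩
  rw [card_filter_univ_succAbove _ i, ← hS]
  simp

theorem card_le_eq_succ_card_lt {n : ℕ} {w : Fin (n + 1) → ℝ} {i : Fin (n + 1)}
    (hw : ∀ j : Fin n, w (i.succAbove j) ≠ w i) :
    (Finset.univ.filter fun j => w j ≤ w i).card =
      (Finset.univ.filter fun j => w j < w i).card + 1 := by
  rw [card_filter_univ_succAbove _ i, card_filter_univ_succAbove (fun j => w j < w i) i]
  simp only [le_refl, lt_irrefl, if_true, if_false, (hw _).le_iff_lt]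
  omega

theorem median_le_iff_exists_mem_medianCell {s : ℕ} {w : Fin (2 * s + 1 + 1) → ℝ}
    (hw : ∀ i (j : Fin (2 * s + 1)), w (i.succAbove j) ≠ w i) (z : ℝ) :
    (orderStat w (s + 1) + orderStat w (s + 1 + 1)) / 2 ≤ z ↔
      ∃ i, ∃ S ∈ Finset.powersetCard s (Finset.univ : Finset (Fin (2 * s + 1))),
        (w i, fun j => w (i.succAbove j)) ∈ medianCell z S := by
  constructor
  · intro h
    obtain ⟨i, hlt, hle⟩ := exists_card_lt_le w (k := s + 1) (by omega) (by omega)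
    rw [orderStat_eq_of_card hlt hle] at h
    have hcard := card_le_eq_succ_card_lt (hw i)
    have hnext := (orderStat_le_iff w (k := s + 1 + 1) (by omega) (by omega) (2 * z - w i)).1
      (by linarith)
    obtain ⟨l, hl, hl'⟩ := Finset.exists_mem_notMem_of_card_lt_card
      (show (Finset.univ.filter fun j => w j ≤ w i).card <
        (Finset.univ.filter fun j => w j ≤ 2 * z - w i).card by omega)
    simp only [Finset.mem_filter, Finset.mem_univ, true_and, not_le] at hl hl'
    obtain ⟨m, rfl⟩ := Fin.exists_succAbove_eq (show l ≠ i by rintro rfl; exact lt_irrefl _ hl')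
    refine ⟨i, Finset.univ.filter fun j => w (i.succAbove j) < w i, ?_, by linarith, ?_, ?_, m, ?_⟩
    · rw [Finset.mem_powersetCard_univ]
      have := card_filter_univ_succAbove (fun j => w j < w i) i
      simp only [lt_irrefl, if_false] at this
      omega
    · simp
    · intro j hj
      simp only [Finset.mem_filter, Finset.mem_univ, true_and, not_lt] at hj
      exact lt_of_le_of_ne hj (hw i j).symm
    · simpa using ⟨hl'.le, hl⟩
  · rintro ⟨i, S, hS, hmem⟩
    rw [Finset.mem_powersetCard_univ] at hS
    obtain ⟨-, hcard⟩ := card_lt_of_mem_medianCell hmem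
    obtain ⟨-, -, h2, m, hm, hmz⟩ := hmem
    have hle := card_le_eq_succ_card_lt (hw i)
    have hfirst : orderStat w (s + 1) = w i := orderStat_eq_of_card (by omega) (by omega)
    have hsecond : orderStat w (s + 1 + 1) ≤ 2 * z - w i := by
      refine (orderStat_le_iff w (by omega) (by omega) _).2 ?_
      have hlt : w i < w (i.succAbove m) := h2 m hm
      have hsub : (Finset.univ.filter fun j => w j ≤ w i) ⊂
          (Finset.univ.filter fun j => w j ≤ 2 * z - w i) := by
        refine Finset.ssubset_iff_of_subset (fun j hj => ?_) |>.2 ⟨i.succAbove m, ?_, ?_⟩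
        · simp only [Finset.mem_filter, Finset.mem_univ, true_and] at hj ⊢
          exact hj.trans (hlt.le.trans hmz)
        · simpa using hmz
        · simpa using hlt
      have := Finset.card_lt_card hsub
      omega
    linarith

theorem medianCell_index_unique {n : ℕ} {w : Fin (n + 1) → ℝ} {z : ℝ} {i i' : Fin (n + 1)}
    {S S' : Finset (Fin n)} (hcard : S.card = S'.card)
    (h : (w i, fun j => w (i.succAbove j)) ∈ medianCell z S)
    (h' : (w i', fun j => w (i'.succAbove j)) ∈ medianCell z S') : i = i' ∧ S = S' := by
  obtain ⟨hS, hc⟩ := card_lt_of_mem_medianCell h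
  obtain ⟨hS', hc'⟩ := card_lt_of_mem_medianCell h'
  have key : ∀ a b : Fin (n + 1), w a < w b → (Finset.univ.filter fun j => w j < w a).card <
      (Finset.univ.filter fun j => w j < w b).card := fun a b hab => by
    refine Finset.card_lt_card
      (Finset.ssubset_iff_of_subset (fun j hj => ?_) |>.2 ⟨a, ?_, ?_⟩)
    · simp only [Finset.mem_filter, Finset.mem_univ, true_and] at hj ⊢
      exact hj.trans hab
    · simpa using hab
    · simp
  have hii : i = i' := by
    rcases lt_trichotomy (w i) (w i') with hlt | heq | hlt
    · have := key _ _ hlt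
      omega
    · by_contra hne
      obtain ⟨j, rfl⟩ := Fin.exists_succAbove_eq (Ne.symm hne)
      by_cases hj : j ∈ S
      · exact (h.2.1 j hj).ne heq.symm
      · exact (h.2.2.1 j hj).ne heq
    · have := key _ _ hlt
      omega
  subst hii
  exact ⟨rfl, hS.trans hS'.symm⟩

theorem pi_real_median_le (μ : Measure ℝ) [IsProbabilityMeasure μ] [NullSingletonClass μ]
    (s : ℕ) (z : ℝ) :
    (Measure.pi fun _ : Fin (2 * s + 1 + 1) => μ).real
        {w | (orderStat w (s + 1) + orderStat w (s + 1 + 1)) / 2 ≤ z} =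
      ((2 * s + 2 : ℕ) : ℝ) * ((2 * s + 1).choose s : ℝ) *
        ∫ x in Iic z, μ.real (Iic x) ^ s * ((1 - μ.real (Iic x)) ^ (s + 1) -
          (1 - μ.real (Iic (2 * z - x))) ^ (s + 1)) ∂μ := by
  set I := (Finset.univ : Finset (Fin (2 * s + 1 + 1))) ×ˢ
    Finset.powersetCard s (Finset.univ : Finset (Fin (2 * s + 1))) with hI
  let cell : Fin (2 * s + 1 + 1) × Finset (Fin (2 * s + 1)) → Set (Fin (2 * s + 1 + 1) → ℝ) :=
    fun q => MeasurableEquiv.piFinSuccAbove (fun _ => ℝ) q.1 ⁻¹' medianCell z q.2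
  have hmem : ∀ q w, w ∈ cell q ↔ (w q.1, fun j => w (q.1.succAbove j)) ∈ medianCell z q.2 :=
    fun q w => Iff.rfl
  have hae : {w : Fin (2 * s + 1 + 1) → ℝ |
      (orderStat w (s + 1) + orderStat w (s + 1 + 1)) / 2 ≤ z} =ᵐ[Measure.pi fun _ => μ]
      ⋃ q ∈ I, cell q := by
    filter_upwards [ae_pi_ne_succAbove μ] with w hw
    refine propext ((median_le_iff_exists_mem_medianCell hw z).trans ?_)
    change _ ↔ w ∈ ⋃ q ∈ I, cell q
    simp [hI, hmem]
  rw [measureReal_congr hae, measureReal_biUnion_finset]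
  · have hq : ∀ q ∈ I, (Measure.pi fun _ : Fin (2 * s + 1 + 1) => μ).real (cell q) =
        ∫ x in Iic z, μ.real (Iic x) ^ s * ((1 - μ.real (Iic x)) ^ (s + 1) -
          (1 - μ.real (Iic (2 * z - x))) ^ (s + 1)) ∂μ := by
      rintro ⟨i, S⟩ hq
      have hS : S.card = s := by simpa [hI] using hq
      have hmp := measurePreserving_piFinSuccAbove (fun _ : Fin (2 * s + 1 + 1) => μ) i
      rw [measureReal_def,
        hmp.measure_preimage (measurableSet_medianCell z S).nullMeasurableSet, ← measureReal_def,
        prod_real_medianCell, hS, show 2 * s + 1 - s = s + 1 by omega]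
    rw [Finset.sum_congr rfl hq, Finset.sum_const, nsmul_eq_mul, hI, Finset.card_product,
      Finset.card_powersetCard, Finset.card_univ, Finset.card_univ, Fintype.card_fin,
      Fintype.card_fin]
    push_cast
    ring
  · rintro ⟨i, S⟩ hq ⟨i', S'⟩ hq' hne
    have hS : S.card = s := by simpa [hI] using hq
    have hS' : S'.card = s := by simpa [hI] using hq'
    refine Set.disjoint_left.2 fun w hw hw' => hne ?_
    obtain ⟨rfl, rfl⟩ := medianCell_index_unique (hS.trans hS'.symm) hw hw'
    rfl
  · exact fun q _ => (MeasurableEquiv.measurable _) (measurableSet_medianCell z q.2)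

section Density

variable {f : ℝ → ℝ}

theorem densMeasure_real (hf0 : ∀ x, 0 ≤ f x) (hf : Integrable f) {s : Set ℝ}
    (hs : MeasurableSet s) : (densMeasure f).real s = ∫ x in s, f x := by
  rw [measureReal_def, densMeasure, withDensity_apply _ hs,
    integral_eq_lintegral_of_nonneg_ae (.of_forall hf0) hf.aestronglyMeasurable.restrict]

theorem isProbabilityMeasure_densMeasure (hf0 : ∀ x, 0 ≤ f x) (hfi : ∫ x, f x = 1) :
    IsProbabilityMeasure (densMeasure f) := by
  refine ⟨?_⟩
  rw [densMeasure, withDensity_apply _ .univ, Measure.restrict_univ,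
    ← ofReal_integral_eq_lintegral_ofReal (integrable_of_integral_eq_one hfi) (.of_forall hf0),
    hfi, ENNReal.ofReal_one]

theorem setIntegral_densMeasure (hf0 : ∀ x, 0 ≤ f x) (hfm : Measurable f) {s : Set ℝ}
    (hs : MeasurableSet s) (g : ℝ → ℝ) :
    ∫ x in s, g x ∂(densMeasure f) = ∫ x in s, g x * f x := by
  rw [densMeasure, restrict_withDensity hs, integral_withDensity_eq_integral_toReal_smul
    hfm.ennreal_ofReal (.of_forall fun _ => ENNReal.ofReal_lt_top)]
  simp [ENNReal.toReal_ofReal (hf0 _), mul_comm]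

end Density

/-- For even `N = 2r` i.i.d. observations with density `f` and distribution
function `F`, the distribution function of the sample median `(Z_{(N/2)} + Z_{(N/2+1)})/2` is
`F_Z^E(z) = (2/B(N/2,N/2)) ∫_{-∞}^z F(x)^{N/2-1} {(1-F(x))^{N/2} - (1-F(2z-x))^{N/2}} f(x) dx`. -/
theorem stmt_16
    (f : ℝ → ℝ) (hf0 : ∀ x, 0 ≤ f x) (hfm : Measurable f) (hfi : ∫ x, f x = 1)
    (F : ℝ → ℝ) (hF : ∀ x, F x = ∫ t in Set.Iic x, f t)
    (N r : ℕ) (hr : 1 ≤ r) (hN : N = 2 * r) (z : ℝ) :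
    ((Measure.pi fun _ : Fin N => densMeasure f)
        {w | (orderStat w (N / 2) + orderStat w (N / 2 + 1)) / 2 ≤ z}).toReal
      = (2 / Beta ((N : ℝ) / 2) ((N : ℝ) / 2)) *
        ∫ x in Set.Iic z, F x ^ (N / 2 - 1) *
          ((1 - F x) ^ (N / 2) - (1 - F (2 * z - x)) ^ (N / 2)) * f x := by
  obtain ⟨s, rfl⟩ : ∃ s, r = s + 1 := ⟨r - 1, by omega⟩
  obtain rfl : N = 2 * s + 1 + 1 := by omega
  have hprob : IsProbabilityMeasure (densMeasure f) := isProbabilityMeasure_densMeasure hf0 hfi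
  have hatoms : NullSingletonClass (densMeasure f) := by
    unfold densMeasure
    infer_instance
  have hcdf : ∀ x, (densMeasure f).real (Iic x) = F x := fun x => by
    rw [hF, densMeasure_real hf0 (integrable_of_integral_eq_one hfi) measurableSet_Iic]
  have hhalf : (2 * s + 1 + 1) / 2 = s + 1 := by omega
  have hcast : ((2 * s + 1 + 1 : ℕ) : ℝ) / 2 = (s : ℝ) + 1 := by
    push_cast
    ring
  rw [hhalf, hcast, two_div_Beta, Nat.add_sub_cancel, ← measureReal_def, pi_real_median_le]
  simp only [hcdf]
  rw [setIntegral_densMeasure hf0 hfm measurableSet_Iic]
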